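/- Fix distinct parties q, q' ∈ Fin 5 and let i be a bifurcation choice belonging to I_pr^{q,q'}, i.e. the number of parties k ∉ {q, q'} with i_lost^k = q is at least 3, and i_ch^q = q'. Then every voting configuration (v_ch, v_pr, l_ch, l_pr) compatible with i satisfies: v_pr^{q→q'} = 1, v_pr^{k→k'} = 0 for every other ordered pair (k,k') with k' ≠ k and (k,k') ≠ (q,q'), and v_ch^{k→k'} = [k' = i_lost^k] for every k ∉ {q, q'} and k' ≠ k. -/

import Mathlib

open Finset

/-- A voting configuration on 5 parties: binary chancellor/president votes
`vch q k`, `vpr q k` (vote of party `q` for party `k`; the diagonal is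
normalized to `0` since only pairs with `k ≠ q` carry a vote), and binary
labels `lch q` (is `q` chancellor?) and `lpr q` (is `q` president?). -/
structure Config where
  vch : Fin 5 → Fin 5 → ℕ
  vpr : Fin 5 → Fin 5 → ℕ
  lch : Fin 5 → ℕ
  lpr : Fin 5 → ℕ
  vch_le : ∀ q k, vch q k ≤ 1
  vpr_le : ∀ q k, vpr q k ≤ 1
  lch_le : ∀ q, lch q ≤ 1
  lpr_le : ∀ q, lpr q ≤ 1
  vch_diag : ∀ q, vch q q = 0
  vpr_diag : ∀ q, vpr q q = 0

/-- The constraints (i)–(iv) on a voting configuration. -/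
def Config.Satisfies (c : Config) : Prop :=
  (∀ q, ∑ k ∈ univ.filter (· ≠ q), c.vch q k ≤ 1) ∧
  (∀ q, ∑ k ∈ univ.filter (· ≠ q), c.vpr q k ≤ c.lch q) ∧
  (∀ q, (c.lch q = 1 ↔ 3 ≤ ∑ k ∈ univ.filter (· ≠ q), c.vch k q)) ∧
  (∀ q, c.lpr q = ∑ k ∈ univ.filter (· ≠ q),
      c.vpr k q *
        (if 3 ≤ ∑ q' ∈ univ.filter (fun x => x ≠ k ∧ x ≠ q), c.vch q' k then 1 else 0))

/-- A bifurcation choice: for each party `q`, a party `ilost q ≠ q`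
(its chancellor vote if it lost) and a party `ich q ≠ q`
(its president vote if it is chancellor). -/
structure Bif where
  ilost : Fin 5 → Fin 5
  ich : Fin 5 → Fin 5
  ilost_ne : ∀ q, ilost q ≠ q
  ich_ne : ∀ q, ich q ≠ q

/-- Compatibility of a voting configuration with a bifurcation choice. -/
def Compatible (c : Config) (i : Bif) : Prop :=
  c.Satisfies ∧
  (∀ q, ¬ (c.lch q = 1 ∧ c.lpr q = 1)) ∧
  (∀ q k, k ≠ q →
    ((c.lch q = 0 ∧ c.lpr q = 0) →
      c.vch q k = (if k = i.ilost q then 1 else 0) ∧ c.vpr q k = 0) ∧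
    ((c.lch q = 1 ∧ c.lpr q = 0) →
      c.vch q k = 0 ∧ c.vpr q k = (if k = i.ich q then 1 else 0)) ∧
    ((c.lch q = 0 ∧ c.lpr q = 1) →
      c.vch q k = 0 ∧ c.vpr q k = 0))

/-- `I_lost`: every party receives strictly fewer than 3 lost-votes. -/
def ILost (i : Bif) : Prop :=
  ∀ q : Fin 5, (univ.filter (fun q' => q' ≠ q ∧ i.ilost q' = q)).card < 3

/-- `I_ch^q`: exactly 3 parties lost-vote for `q`, and the party `q` would
president-vote for lost-votes for `q`. -/
def ICh (q : Fin 5) (i : Bif) : Prop :=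
  (univ.filter (fun q' => q' ≠ q ∧ i.ilost q' = q)).card = 3 ∧ i.ilost (i.ich q) = q

/-- `I_pr^{q,q'}`: at least 3 parties outside `{q, q'}` lost-vote for `q`,
and `q` would president-vote for `q'`. -/
def IPr (q q' : Fin 5) (i : Bif) : Prop :=
  3 ≤ (univ.filter (fun k => k ≠ q ∧ k ≠ q' ∧ i.ilost k = q)).card ∧ i.ich q = q'

/-- In `I_pr^{q,q'}`, every party outside `{q, q'}` lost-votes for `q`. -/
theorem IPr.ilost_eq {q q' : Fin 5} (hqq : q ≠ q') {i : Bif} (hi : IPr q q' i)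
    {k : Fin 5} (hk : k ≠ q) (hk' : k ≠ q') : i.ilost k = q := by
  have hcard : (univ.filter (fun k : Fin 5 => k ≠ q ∧ k ≠ q')).card = 3 := by
    clear hi hk hk'
    revert q q'
    decide
  have hsub : univ.filter (fun k => k ≠ q ∧ k ≠ q' ∧ i.ilost k = q) ⊆
      univ.filter (fun k : Fin 5 => k ≠ q ∧ k ≠ q') := by
    intro x hx
    simp only [mem_filter, mem_univ, true_and] at hx ⊢
    exact ⟨hx.1, hx.2.1⟩
  have hmem : k ∈ univ.filter (fun k => k ≠ q ∧ k ≠ q' ∧ i.ilost k = q) := by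
    rw [eq_of_subset_of_card_le hsub (hcard ▸ hi.1)]
    simp [hk, hk']
  simp only [mem_filter, mem_univ, true_and] at hmem
  exact hmem.2.2

/-- A chancellor vote is only ever cast for the lost-vote. -/
theorem Compatible.vch_eq_zero {c : Config} {i : Bif} (hc : Compatible c i)
    {k m : Fin 5} (hmk : m ≠ k) (hm : m ≠ i.ilost k) : c.vch k m = 0 := by
  obtain ⟨-, hnot, hcases⟩ := hc
  obtain ⟨h00, h10, h01⟩ := hcases k m hmk
  have h1 := c.lch_le k
  have h2 := c.lpr_le k
  have h3 := hnot k
  by_cases hch : c.lch k = 1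
  · exact (h10 ⟨hch, by omega⟩).1
  by_cases hpr : c.lpr k = 1
  · exact (h01 ⟨by omega, hpr⟩).1
  · simpa [hm] using (h00 ⟨by omega, by omega⟩).1

/-- In `I_pr^{q,q'}`, no party other than `q` is chancellor. -/
theorem Compatible.lch_eq_zero {q q' : Fin 5} (hqq : q ≠ q') {i : Bif} (hi : IPr q q' i)
    {c : Config} (hc : Compatible c i) {m : Fin 5} (hm : m ≠ q) : c.lch m = 0 := by
  by_contra hne
  have hge := (hc.1.2.2.1 m).1 (by have := c.lch_le m; omega)
  have hsum : ∑ k ∈ univ.filter (· ≠ m), c.vch k m ≤ ∑ k ∈ ({q, q'} : Finset (Fin 5)), 1 := by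
    calc ∑ k ∈ univ.filter (· ≠ m), c.vch k m
        ≤ ∑ k ∈ univ.filter (· ≠ m), if k ∈ ({q, q'} : Finset (Fin 5)) then 1 else 0 := by
          refine sum_le_sum fun k hk => ?_
          split_ifs with h
          · exact c.vch_le k m
          · simp only [mem_insert, mem_singleton, not_or] at h
            refine (hc.vch_eq_zero (mem_filter.1 hk).2.symm ?_).le
            rwa [hi.ilost_eq hqq h.1 h.2]
      _ ≤ ∑ k, if k ∈ ({q, q'} : Finset (Fin 5)) then 1 else 0 :=
          sum_le_sum_of_subset (filter_subset _ _)
      _ = _ := by rw [sum_ite_mem, univ_inter]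
  rw [sum_const, card_pair hqq, smul_eq_mul] at hsum
  omega

/-- If the bifurcation choice lies in I_pr^{q,q'}, then in any compatible
configuration the only president vote is the one of q for q', and the
parties other than q, q' cast their lost-votes. -/
theorem IPr_votes (q q' : Fin 5) (hqq : q ≠ q')
    (i : Bif) (hi : IPr q q' i) (c : Config) (hc : Compatible c i) :
    c.vpr q q' = 1 ∧
    (∀ k k' : Fin 5, k' ≠ k → ¬(k = q ∧ k' = q') → c.vpr k k' = 0) ∧
    (∀ k k' : Fin 5, k ≠ q → k ≠ q' → k' ≠ k →
      c.vch k k' = (if k' = i.ilost k then 1 else 0)) := by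
  have hch0 : ∀ m, m ≠ q → c.lch m = 0 := fun m hm => hc.lch_eq_zero hqq hi hm
  obtain ⟨⟨-, hpr_sum, hch_iff, hlpr⟩, hnot, hcases⟩ := hc
  have hpr_zero : ∀ k m, m ≠ k → c.lch k = 0 → c.vpr k m = 0 := by
    intro k m hmk hk
    have h := hpr_sum k
    rw [hk, Nat.le_zero, sum_eq_zero_iff] at h
    exact h m (by simp [hmk])
  have hlpr_zero : ∀ m, c.lch m = 1 → c.lpr m = 0 := by
    intro m hm
    have := hnot m
    have := c.lpr_le m
    omega
  have hq_zero : ∀ m, m ≠ q → m ≠ q' → c.vpr q m = 0 := by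
    intro m hm hm'
    by_cases h : c.lch q = 1
    · simpa [hi.2, hm'] using ((hcases q m hm).2.1 ⟨h, hlpr_zero q h⟩).2
    · exact hpr_zero q m hm (by have := c.lch_le q; omega)
  have hvpr : ∀ k k' : Fin 5, k' ≠ k → ¬(k = q ∧ k' = q') → c.vpr k k' = 0 := by
    intro k k' hk hne
    by_cases hkq : k = q
    · subst hkq
      exact hq_zero k' hk fun h => hne ⟨rfl, h⟩
    · exact hpr_zero k k' hk (hch0 k hkq)
  have hvch : ∀ k k' : Fin 5, k ≠ q → k ≠ q' → k' ≠ k →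
      c.vch k k' = (if k' = i.ilost k then 1 else 0) := by
    intro k k' hk hk' hne
    have hlost : c.lpr k = 0 := by
      rw [hlpr k]
      refine sum_eq_zero fun x hx => ?_
      rw [hvpr x k (mem_filter.1 hx).2.symm fun h => hk' h.2, zero_mul]
    exact ((hcases k k' hne).1 ⟨hch0 k hk, hlost⟩).1
  refine ⟨?_, hvpr, hvch⟩
  have hq : c.lch q = 1 := by
    refine (hch_iff q).2 (hi.1.trans ?_)
    rw [card_eq_sum_ones]
    calc ∑ k ∈ univ.filter (fun k => k ≠ q ∧ k ≠ q' ∧ i.ilost k = q), 1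
        ≤ ∑ k ∈ univ.filter (fun k => k ≠ q ∧ k ≠ q' ∧ i.ilost k = q), c.vch k q := by
          refine sum_le_sum fun k hk => ?_
          obtain ⟨h1, h2, h3⟩ := (mem_filter.1 hk).2
          rw [hvch k q h1 h2 h1.symm, if_pos h3.symm]
      _ ≤ ∑ k ∈ univ.filter (· ≠ q), c.vch k q := by
          refine sum_le_sum_of_subset fun k hk => ?_
          exact mem_filter.2 ⟨mem_univ k, (mem_filter.1 hk).2.1⟩
  simpa [hi.2] using ((hcases q q' hqq.symm).2.1 ⟨hq, hlpr_zero q hq⟩).2
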